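/- Let f : ℂ → ℂ be smooth (C^∞) with compact support contained in the open unit disc 𝔻, let g(t) = f(t)/(t−1), and define T₁f(ζ) = (ζ−1)·( Tg(ζ) + ζ^{−1}·conj( Tg(1/conj(ζ)) ) ). Then T₁f is (real-)differentiable at every ζ ∈ 𝔻∖{0}, and it solves the ∂̄-equation there: (1/2)( ∂_x(T₁f)(ζ) + i·∂_y(T₁f)(ζ) ) = f(ζ) for all ζ ∈ 𝔻∖{0}. -/

import Mathlib

open Metric MeasureTheory

/-- The Cauchy–Green operator
`Tf(ζ) = (1/(2πi)) ∬_𝔻 f(t)/(t−ζ) dt∧dt̄ = −(1/π) ∬_𝔻 f(t)/(t−ζ) dA(t)`. -/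
noncomputable def cauchyGreen (f : ℂ → ℂ) (ζ : ℂ) : ℂ :=
  -(Real.pi : ℂ)⁻¹ * ∫ t in ball (0 : ℂ) 1, f t / (t - ζ)

/-- The Vekua-modified Cauchy–Green operator with weight `Q(ζ) = ζ − 1`:
`T₁f(ζ) = (ζ−1)·( T(f/Q)(ζ) + ζ⁻¹·conj( T(f/Q)(1/conj ζ) ) )`. -/
noncomputable def vekuaT1 (f : ℂ → ℂ) (ζ : ℂ) : ℂ :=
  (ζ - 1) * (cauchyGreen (fun t => f t / (t - 1)) ζ
    + ζ⁻¹ * (starRingEnd ℂ) (cauchyGreen (fun t => f t / (t - 1)) (1 / (starRingEnd ℂ) ζ)))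

namespace VekuaAux

/-- `e^{iθ}` in the form used by `Complex.polarCoord`. -/
noncomputable def E (θ : ℝ) : ℂ := (Real.cos θ : ℂ) + (Real.sin θ : ℂ) * Complex.I

lemma E_continuous : Continuous E := by
  unfold E; fun_prop

lemma E_ne_zero (θ : ℝ) : E θ ≠ 0 := by
  intro h
  have h1 : ‖E θ‖ = 1 := by
    have := Complex.norm_exp_ofReal_mul_I θ
    rw [Complex.exp_mul_I] at this
    simpa [E] using this
  rw [h] at h1; simp at h1

lemma E_norm (θ : ℝ) : ‖E θ‖ = 1 := by
  have := Complex.norm_exp_ofReal_mul_I θ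
  rw [Complex.exp_mul_I] at this
  simpa [E] using this

lemma E_hasDerivAt (θ : ℝ) : HasDerivAt E (Complex.I * E θ) θ := by
  have h1 := (Real.hasDerivAt_cos θ).ofReal_comp
  have h2 := ((Real.hasDerivAt_sin θ).ofReal_comp).mul_const Complex.I
  refine (h1.add h2).congr_deriv ?_
  unfold E
  push_cast
  linear_combination (-(Complex.sin θ)) * Complex.I_sq

lemma clm_polar (L : ℂ →L[ℝ] ℂ) (θ : ℝ) :
    L 1 + Complex.I * L Complex.I = E θ * (L (E θ) + Complex.I * L (Complex.I * E θ)) := by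
  have h1 : L (E θ) = Real.cos θ * L 1 + Real.sin θ * L Complex.I := by
    have : E θ = Real.cos θ • (1 : ℂ) + Real.sin θ • Complex.I := by simp [E]
    rw [this, map_add, map_smul, map_smul]; simp
  have h2 : L (Complex.I * E θ) = -Real.sin θ * L 1 + Real.cos θ * L Complex.I := by
    have : Complex.I * E θ = (-Real.sin θ) • (1 : ℂ) + Real.cos θ • Complex.I := by
      simp [E]; linear_combination (Complex.sin θ) * Complex.I_sq
    rw [this, map_add, map_smul, map_smul]; simp
  rw [h1, h2]
  have h3 : (Real.cos θ : ℂ) ^ 2 + (Real.sin θ : ℂ) ^ 2 = 1 := by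
    exact_mod_cast Real.cos_sq_add_sin_sq θ
  unfold E
  have hI := Complex.I_sq
  generalize (Real.cos θ : ℂ) = c at *
  generalize (Real.sin θ : ℂ) = s at *
  linear_combination (-(L 1) - Complex.I * L Complex.I) * h3 + (s ^ 2 * L 1 - s * c * L Complex.I) * hI

lemma integrableOn_polar {F : ℝ × ℝ → ℂ} (hF : Continuous F) {R : ℝ}
    (hR : ∀ p : ℝ × ℝ, R < p.1 → F p = 0) :
    IntegrableOn F (Set.Ioi (0 : ℝ) ×ˢ Set.Ioo (-Real.pi) Real.pi) := by
  have h1 : IntegrableOn F (Set.Icc (0 : ℝ) R ×ˢ Set.Icc (-Real.pi) Real.pi) :=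
    hF.continuousOn.integrableOn_compact (isCompact_Icc.prod isCompact_Icc)
  refine h1.of_forall_sdiff_eq_zero (measurableSet_Ioi.prod measurableSet_Ioo) ?_
  rintro ⟨r, θ⟩ ⟨⟨hr, hθ⟩, h⟩
  apply hR
  by_contra hc
  exact h ⟨⟨le_of_lt hr, not_lt.1 hc⟩, ⟨hθ.1.le, hθ.2.le⟩⟩

lemma radial (h : ℂ → ℂ) (hh : ContDiff ℝ 1 h) {R : ℝ} (hR : ∀ z, R < ‖z‖ → h z = 0)
    (hR' : ∀ z, R < ‖z‖ → fderiv ℝ h z = 0) (θ : ℝ) :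
    ∫ r in Set.Ioi (0 : ℝ), fderiv ℝ h ((r : ℂ) * E θ) (E θ) = - h 0 := by
  have hd : ∀ r : ℝ, HasDerivAt (fun r : ℝ => h ((r : ℂ) * E θ))
      (fderiv ℝ h ((r : ℂ) * E θ) (E θ)) r := by
    intro r
    have h1 : HasDerivAt (fun r : ℝ => (r : ℂ) * E θ) (E θ) r := by
      simpa using (Complex.ofRealCLM.hasDerivAt (x := r)).mul_const (E θ)
    exact ((hh.differentiable one_ne_zero) ((r : ℂ) * E θ)).hasFDerivAt.comp_hasDerivAt r h1
  have hnorm : ∀ r : ℝ, R < r → R < ‖(r : ℂ) * E θ‖ := by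
    intro r hr
    rw [norm_mul, E_norm, mul_one, Complex.norm_real]
    exact hr.trans_le (le_abs_self r)
  have hc : Continuous (fun r : ℝ => fderiv ℝ h ((r : ℂ) * E θ) (E θ)) := by
    have := hh.continuous_fderiv one_ne_zero
    fun_prop
  have hi : IntegrableOn (fun r : ℝ => fderiv ℝ h ((r : ℂ) * E θ) (E θ)) (Set.Ioi 0) := by
    have h1 := hc.continuousOn.integrableOn_compact (isCompact_Icc (a := (0 : ℝ)) (b := R))
      (μ := volume)
    refine h1.of_forall_sdiff_eq_zero measurableSet_Ioi ?_
    rintro r ⟨hr, h'⟩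
    have : R < r := by
      by_contra hc
      exact h' ⟨le_of_lt hr, not_lt.1 hc⟩
    rw [hR' _ (hnorm r this)]; simp
  have ht : Filter.Tendsto (fun r : ℝ => h ((r : ℂ) * E θ)) Filter.atTop (nhds 0) := by
    refine tendsto_const_nhds.congr' ?_
    filter_upwards [Filter.eventually_gt_atTop R] with r hr
    exact (hR _ (hnorm r hr)).symm
  have := integral_Ioi_of_hasDerivAt_of_tendsto' (a := (0 : ℝ)) (fun x _ => hd x) hi ht
  simpa using this

lemma angular (h : ℂ → ℂ) (hh : ContDiff ℝ 1 h) {r : ℝ} (hr : 0 < r) :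
    ∫ θ in Set.Ioo (-Real.pi) Real.pi, fderiv ℝ h ((r : ℂ) * E θ) (Complex.I * E θ) = 0 := by
  have hd : ∀ θ : ℝ, HasDerivAt (fun θ : ℝ => h ((r : ℂ) * E θ))
      (r * fderiv ℝ h ((r : ℂ) * E θ) (Complex.I * E θ)) θ := by
    intro θ
    have h1 : HasDerivAt (fun θ : ℝ => (r : ℂ) * E θ) (r • (Complex.I * E θ)) θ := by
      simpa using (E_hasDerivAt θ).const_mul (r : ℂ)
    have := ((hh.differentiable one_ne_zero) ((r : ℂ) * E θ)).hasFDerivAt.comp_hasDerivAt θ h1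
    refine this.congr_deriv ?_
    rw [map_smul, Complex.real_smul]
  have hc : Continuous (fun θ : ℝ => (r : ℂ) * fderiv ℝ h ((r : ℂ) * E θ) (Complex.I * E θ)) := by
    have := hh.continuous_fderiv one_ne_zero
    have := E_continuous
    fun_prop
  have h2 := intervalIntegral.integral_eq_sub_of_hasDerivAt (a := -Real.pi) (b := Real.pi)
    (fun x _ => hd x) (hc.intervalIntegrable _ _)
  have h3 : E Real.pi = E (-Real.pi) := by simp [E]
  rw [h3, sub_self, intervalIntegral.integral_const_mul,
    intervalIntegral.integral_of_le (by linarith [Real.pi_pos]), integral_Ioc_eq_integral_Ioo] at h2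
  rcases mul_eq_zero.1 h2 with h4 | h4
  · exact absurd (Complex.ofReal_eq_zero.1 h4) hr.ne'
  · exact h4

/-- Cauchy–Pompeiu at the origin. -/
lemma pompeiu (h : ℂ → ℂ) (hh : ContDiff ℝ 1 h) (hs : HasCompactSupport h) :
    ∫ t, t⁻¹ * (fderiv ℝ h t 1 + Complex.I * fderiv ℝ h t Complex.I) = -(2 * Real.pi * h 0) := by
  obtain ⟨R, hR0⟩ := hs.isCompact.isBounded.subset_closedBall (0 : ℂ)
  have hR : ∀ z, R < ‖z‖ → h z = 0 := by
    intro z hz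
    apply image_eq_zero_of_notMem_tsupport
    intro hm
    have := hR0 hm
    rw [mem_closedBall_zero_iff] at this
    linarith
  have hR' : ∀ z, R < ‖z‖ → fderiv ℝ h z = 0 := by
    intro z hz
    apply fderiv_of_notMem_tsupport
    intro hm
    have := hR0 hm
    rw [mem_closedBall_zero_iff] at this
    linarith
  have hcf := hh.continuous_fderiv one_ne_zero
  have hcE := E_continuous
  have hnorm : ∀ p : ℝ × ℝ, R < p.1 → R < ‖(p.1 : ℂ) * E p.2‖ := by
    intro p hr
    rw [norm_mul, E_norm, mul_one, Complex.norm_real]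
    exact hr.trans_le (le_abs_self _)
  have hA : IntegrableOn (fun p : ℝ × ℝ => fderiv ℝ h ((p.1 : ℂ) * E p.2) (E p.2))
      (Set.Ioi (0 : ℝ) ×ˢ Set.Ioo (-Real.pi) Real.pi) := by
    refine integrableOn_polar (R := R) (by fun_prop) ?_
    intro p hp
    rw [hR' _ (hnorm p hp)]; simp
  have hB : IntegrableOn (fun p : ℝ × ℝ => fderiv ℝ h ((p.1 : ℂ) * E p.2) (Complex.I * E p.2))
      (Set.Ioi (0 : ℝ) ×ˢ Set.Ioo (-Real.pi) Real.pi) := by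
    refine integrableOn_polar (R := R) (by fun_prop) ?_
    intro p hp
    rw [hR' _ (hnorm p hp)]; simp
  rw [← Complex.integral_comp_polarCoord_symm]
  have hcongr : ∀ p ∈ polarCoord.target, p.1 • ((Complex.polarCoord.symm p)⁻¹ *
      (fderiv ℝ h (Complex.polarCoord.symm p) 1
        + Complex.I * fderiv ℝ h (Complex.polarCoord.symm p) Complex.I))
      = fderiv ℝ h ((p.1 : ℂ) * E p.2) (E p.2)
        + Complex.I * fderiv ℝ h ((p.1 : ℂ) * E p.2) (Complex.I * E p.2) := by
    intro p hp
    have hp0 : (p.1 : ℂ) ≠ 0 := by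
      have : 0 < p.1 := hp.1
      exact_mod_cast this.ne'
    have hsymm : Complex.polarCoord.symm p = (p.1 : ℂ) * E p.2 := by
      rw [Complex.polarCoord_symm_apply]; rfl
    rw [hsymm, clm_polar _ p.2, Complex.real_smul]
    have := E_ne_zero p.2
    field_simp
  rw [setIntegral_congr_fun polarCoord.open_target.measurableSet hcongr]
  change ∫ p in Set.Ioi (0 : ℝ) ×ˢ Set.Ioo (-Real.pi) Real.pi, _ = _
  rw [integral_add hA (hB.const_mul Complex.I), integral_const_mul]
  have iB : ∫ p in Set.Ioi (0 : ℝ) ×ˢ Set.Ioo (-Real.pi) Real.pi,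
      fderiv ℝ h ((p.1 : ℂ) * E p.2) (Complex.I * E p.2) = 0 := by
    rw [Measure.volume_eq_prod] at hB ⊢
    rw [setIntegral_prod _ hB]
    rw [setIntegral_congr_fun (g := fun _ => (0 : ℂ)) measurableSet_Ioi
      (fun r hr => angular h hh hr)]
    simp
  have iA : ∫ p in Set.Ioi (0 : ℝ) ×ˢ Set.Ioo (-Real.pi) Real.pi,
      fderiv ℝ h ((p.1 : ℂ) * E p.2) (E p.2) = -(2 * Real.pi * h 0) := by
    rw [Measure.volume_eq_prod] at hA ⊢
    rw [IntegrableOn, ← Measure.prod_restrict] at hA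
    rw [← Measure.prod_restrict, integral_prod_symm _ hA]
    simp only [radial h hh hR hR']
    rw [setIntegral_const, measureReal_def, Real.volume_Ioo,
      ENNReal.toReal_ofReal (by linarith [Real.pi_pos]), Complex.real_smul]
    push_cast
    ring
  rw [iA, iB]
  simp

lemma locInt : LocallyIntegrable (fun z : ℂ => -z⁻¹) volume := by
  refine locallyIntegrable_of_norm_le_rpow (C := 1) (α := 1) ?_ ?_ ?_ ?_
  · simp
  · simp
  · refine Filter.Eventually.of_forall fun z => ?_
    simp [Real.rpow_neg_one]
  · exact (measurable_inv.neg).aestronglyMeasurable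

open scoped Convolution in
/-- `Tg` is real differentiable and `∂̄ Tg = g`. -/
lemma cauchyGreen_dbar (g : ℂ → ℂ) (hg : ContDiff ℝ 1 g) (hs : HasCompactSupport g)
    (hs' : tsupport g ⊆ ball (0 : ℂ) 1) (ζ : ℂ) :
    DifferentiableAt ℝ (cauchyGreen g) ζ ∧
      (2 : ℂ)⁻¹ * (fderiv ℝ (cauchyGreen g) ζ 1
        + Complex.I * fderiv ℝ (cauchyGreen g) ζ Complex.I) = g ζ := by
  set L := ContinuousLinearMap.mul ℝ ℂ with hL
  set k : ℂ → ℂ := fun z => -z⁻¹ with hk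
  have heq : cauchyGreen g = fun ζ => -(Real.pi : ℂ)⁻¹ * (k ⋆[L, volume] g) ζ := by
    funext z
    unfold cauchyGreen
    congr 1
    rw [convolution_eq_swap, setIntegral_eq_integral_of_forall_compl_eq_zero]
    · congr 1
      funext t
      simp only [hL, hk, ContinuousLinearMap.mul_apply']
      rw [← inv_neg, neg_sub, div_eq_mul_inv, mul_comm]
    · intro t ht
      rw [image_eq_zero_of_notMem_tsupport (fun h => ht (hs' h)), zero_div]
  have hD := (hs.hasFDerivAt_convolution_right L locInt hg ζ).const_mul (-(Real.pi : ℂ)⁻¹)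
  rw [← heq] at hD
  refine ⟨hD.differentiableAt, ?_⟩
  have hcf := hg.continuous_fderiv one_ne_zero
  have hv : ∀ v : ℂ, fderiv ℝ (cauchyGreen g) ζ v
      = -(Real.pi : ℂ)⁻¹ * ∫ t, -t⁻¹ * fderiv ℝ g (ζ - t) v := by
    intro v
    rw [hD.fderiv]
    change -(Real.pi : ℂ)⁻¹ * ((k ⋆[L.precompR ℂ, volume] fderiv ℝ g) ζ v) = _
    rw [convolution_precompR_apply L locInt (hs.fderiv ℝ) hcf]
    rfl
  have hint : ∀ v : ℂ, Integrable (fun t => -t⁻¹ * fderiv ℝ g (ζ - t) v) := by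
    intro v
    exact HasCompactSupport.convolutionExists_right L (hs.fderiv_apply ℝ v) locInt
      (by fun_prop) ζ
  have hp := pompeiu (fun t => g (ζ - t)) (hg.comp (by fun_prop))
    (hs.comp_homeomorph (Homeomorph.subLeft ζ))
  have hfd : ∀ t v : ℂ, fderiv ℝ (fun t => g (ζ - t)) t v = - fderiv ℝ g (ζ - t) v := by
    intro t v
    have h1 : HasFDerivAt (fun t : ℂ => ζ - t) (-(ContinuousLinearMap.id ℝ ℂ)) t :=
      (hasFDerivAt_id t).const_sub ζ
    have h2 := ((hg.differentiable one_ne_zero) (ζ - t)).hasFDerivAt.comp t h1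
    have h3 : HasFDerivAt (fun t => g (ζ - t)) _ t := h2
    rw [h3.fderiv]
    simp
  simp only [hfd, sub_zero] at hp
  rw [hv, hv]
  have : ∫ t, t⁻¹ * (-fderiv ℝ g (ζ - t) 1 + Complex.I * -fderiv ℝ g (ζ - t) Complex.I)
      = (∫ t, -t⁻¹ * fderiv ℝ g (ζ - t) 1)
        + Complex.I * ∫ t, -t⁻¹ * fderiv ℝ g (ζ - t) Complex.I := by
    rw [← integral_const_mul, ← integral_add (hint 1) ((hint Complex.I).const_mul _)]
    congr 1
    funext t
    ring
  rw [this] at hp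
  have hpi : (Real.pi : ℂ) ≠ 0 := by exact_mod_cast Real.pi_ne_zero
  generalize (∫ t, -t⁻¹ * fderiv ℝ g (ζ - t) 1) = X at *
  generalize (∫ t, -t⁻¹ * fderiv ℝ g (ζ - t) Complex.I) = Y at *
  have hX : X = -(2 * Real.pi * g ζ) - Complex.I * Y := by linear_combination hp
  rw [hX]
  field_simp
  ring

end VekuaAux

/-- For `f` smooth with compact support in the unit disc, `T₁f` is differentiable on
`𝔻 ∖ {0}` and solves the `∂̄`-equation there:
`(1/2)(∂ₓ(T₁f) + i ∂_y(T₁f)) = f`. -/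
theorem vekuaT1_solves_dbar (f : ℂ → ℂ) (hf : ContDiff ℝ (⊤ : ℕ∞) f)
    (hsupp : HasCompactSupport f) (hsupp' : tsupport f ⊆ ball (0 : ℂ) 1) :
    ∀ ζ ∈ ball (0 : ℂ) 1 \ {0}, DifferentiableAt ℝ (vekuaT1 f) ζ ∧
      (2 : ℂ)⁻¹ * (fderiv ℝ (vekuaT1 f) ζ 1 + Complex.I * fderiv ℝ (vekuaT1 f) ζ Complex.I)
        = f ζ := by
  rintro ζ ⟨hζ, hζ0⟩
  have hζ0 : ζ ≠ 0 := hζ0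
  have hζn : ‖ζ‖ < 1 := by simpa using hζ
  have hζ1 : ζ - 1 ≠ 0 := by
    intro h
    rw [sub_eq_zero.1 h] at hζn
    simp at hζn
  set g : ℂ → ℂ := fun t => f t / (t - 1) with hgdef
  have hsub : tsupport g ⊆ tsupport f := by
    apply closure_mono
    intro t ht h0
    exact ht (by simp [hgdef, h0])
  have hgs : HasCompactSupport g := hsupp.of_isClosed_subset (isClosed_tsupport g) hsub
  have hgs' := hsub.trans hsupp'
  have hg : ContDiff ℝ 1 g := by
    rw [contDiff_iff_contDiffAt]
    intro t
    by_cases ht : t = 1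
    · have hn : t ∉ tsupport g := by
        intro h
        have := hgs' h
        rw [ht] at this
        simp at this
      have : g =ᶠ[nhds t] fun _ => 0 := notMem_tsupport_iff_eventuallyEq.1 hn
      exact contDiffAt_const.congr_of_eventuallyEq this
    · have h1 : ContDiffAt ℝ 1 f t := (hf.of_le (by exact_mod_cast le_top)).contDiffAt
      have h2 : ContDiffAt ℝ 1 (fun t : ℂ => (t - 1)⁻¹) t :=
        ContDiffAt.inv (by fun_prop) (sub_ne_zero.2 ht)
      have h3 := h1.mul h2
      refine h3.congr_of_eventuallyEq (Filter.Eventually.of_forall fun z => ?_)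
      simp [hgdef, div_eq_mul_inv]
  obtain ⟨hT, hTd⟩ := VekuaAux.cauchyGreen_dbar g hg hgs hgs' ζ
  obtain ⟨hW, hWd⟩ := VekuaAux.cauchyGreen_dbar g hg hgs hgs' (starRingEnd ℂ ζ⁻¹)
  have hgw : g (starRingEnd ℂ ζ⁻¹) = 0 := by
    apply image_eq_zero_of_notMem_tsupport
    intro h
    have := hgs' h
    rw [mem_ball_zero_iff, RCLike.norm_conj, norm_inv] at this
    exact absurd this (not_lt.2 ((one_lt_inv₀ (norm_pos_iff.2 hζ0)).2 hζn).le)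
  have hWc : DifferentiableAt ℂ (cauchyGreen g) (starRingEnd ℂ ζ⁻¹) := by
    rw [differentiableAt_complex_iff_differentiableAt_real]
    refine ⟨hW, ?_⟩
    rw [hgw] at hWd
    rw [smul_eq_mul]
    linear_combination (-2 * Complex.I) * hWd + fderiv ℝ (cauchyGreen g) (starRingEnd ℂ ζ⁻¹) Complex.I * Complex.I_sq
  have hH : DifferentiableAt ℂ
      (fun z => z⁻¹ * (starRingEnd ℂ) (cauchyGreen g (1 / (starRingEnd ℂ) z))) ζ := by
    have h1 := hWc.conj_conj
    rw [Complex.conj_conj] at h1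
    have h2 : DifferentiableAt ℂ (fun z : ℂ => z⁻¹) ζ := differentiableAt_inv hζ0
    have h3 := h2.mul (DifferentiableAt.comp ζ h1 h2)
    refine h3.congr_of_eventuallyEq (Filter.Eventually.of_forall fun z => ?_)
    simp
  obtain ⟨hHr, hHd⟩ := differentiableAt_complex_iff_differentiableAt_real.1 hH
  set H := fun z => z⁻¹ * (starRingEnd ℂ) (cauchyGreen g (1 / (starRingEnd ℂ) z)) with hHdef
  have hfun : vekuaT1 f = fun z => (z - 1) * (cauchyGreen g z + H z) := rfl
  have hQ : HasFDerivAt (fun z : ℂ => z - 1) (ContinuousLinearMap.id ℝ ℂ) ζ :=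
    (hasFDerivAt_id ζ).sub_const 1
  have hD := hQ.mul (hT.hasFDerivAt.add hHr.hasFDerivAt)
  have hD' : HasFDerivAt (vekuaT1 f) _ ζ := hD
  refine ⟨hD'.differentiableAt, ?_⟩
  rw [hD'.fderiv]
  simp only [ContinuousLinearMap.add_apply, ContinuousLinearMap.smul_apply, smul_eq_mul,
    ContinuousLinearMap.id_apply, hHd, Pi.add_apply]
  have hfz : f ζ = (ζ - 1) * g ζ := by
    simp only [hgdef]; field_simp
  rw [hfz, ← hTd]
  linear_combination (2⁻¹ * ((ζ - 1) * fderiv ℝ H ζ 1 + (cauchyGreen g ζ + H ζ))) * Complex.I_sq
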